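/- For every ε > 0, w.h.p. the number of connected components of Q^n(1) lies between (1−ε)·2^{n−1}/n and (1+ε)·2^{n−1}/n. -/

import Mathlib

open scoped Classical
open Filter

noncomputable section

/-- The vertex set of the `n`-dimensional hypercube: `{0,1}^n`. -/
abbrev Vtx (n : ℕ) := Fin n → Bool

/-- The `n`-dimensional hypercube graph `Q^n`: two vertices are adjacent iff they
differ in exactly one coordinate. -/
def cubeGraph (n : ℕ) : SimpleGraph (Vtx n) :=
  SimpleGraph.fromRel (fun u v => hammingDist u v = 1)

/-- Sample space: every vertex independently chooses a uniformly random neighbour. -/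
abbrev NbrChoice (n : ℕ) := ∀ v : Vtx n, {u : Vtx n // (cubeGraph n).Adj v u}

/-- The random graph `Q^n(1)`, with edge set `{{v, f(v)} : v ∈ V}`. -/
def oneOutGraph (n : ℕ) (ω : NbrChoice n) : SimpleGraph (Vtx n) :=
  SimpleGraph.fromRel (fun u v => (ω u : Vtx n) = v)

/-- Uniform (counting) probability of an event on a finite sample space. -/
def prob {Ω : Type*} [Finite Ω] (p : Ω → Prop) : ℝ :=
  (Nat.card {ω : Ω // p ω} : ℝ) / (Nat.card Ω : ℝ)

theorem reachable_iff_exists_iterate_eq {V : Type*} (f : V → V) (u v : V) :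
    (SimpleGraph.fromRel fun a b => f a = b).Reachable u v ↔ ∃ i j, f^[i] u = f^[j] v := by
  have reachable_iterate : ∀ (i : ℕ) (a : V),
      (SimpleGraph.fromRel fun a b => f a = b).Reachable a (f^[i] a) := by
    intro i
    induction i with
    | zero => exact fun a => SimpleGraph.Reachable.refl a
    | succ i ih =>
      intro a
      rw [Function.iterate_succ_apply]
      refine SimpleGraph.Reachable.trans ?_ (ih (f a))
      by_cases h : a = f a
      · rw [← h]
      · exact SimpleGraph.Adj.reachable (by simp [SimpleGraph.fromRel_adj, h])
  constructor
  · rintro ⟨w⟩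
    induction w with
    | nil => exact ⟨0, 0, rfl⟩
    | cons h _ ih =>
      obtain ⟨i, j, hij⟩ := ih
      rw [SimpleGraph.fromRel_adj] at h
      rcases h.2 with h | h
      · exact ⟨i + 1, j, by rw [Function.iterate_succ_apply, h, hij]⟩
      · refine ⟨i, j + 1, ?_⟩
        rw [← h, ← Function.iterate_succ_apply, Function.iterate_succ_apply', hij,
          Function.iterate_succ_apply']
  · rintro ⟨i, j, h⟩
    exact (reachable_iterate i u).trans (h ▸ (reachable_iterate j v).symm)

theorem card_connectedComponent_eq_sum_inv_minimalPeriod {V : Type*} [Fintype V] (f : V → V) :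
    (Nat.card (SimpleGraph.fromRel fun a b => f a = b).ConnectedComponent : ℝ) =
      ∑ v, (Function.minimalPeriod f v : ℝ)⁻¹ := by
  set G := SimpleGraph.fromRel fun a b => f a = b
  rw [Nat.card_eq_fintype_card, ← Finset.sum_fiberwise Finset.univ G.connectedComponentMk,
    Fintype.card, Finset.cast_card]
  refine Finset.sum_congr rfl fun c _ => ?_
  induction c using SimpleGraph.ConnectedComponent.ind with | _ w => ?_
  obtain ⟨k, l, hkl, hw⟩ : ∃ k l, k < l ∧ f^[k] w = f^[l] w := by
    obtain ⟨k, l, hne, h⟩ := Finite.exists_ne_map_eq_of_infinite fun k => f^[k] w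
    rcases hne.lt_or_gt with h' | h'
    exacts [⟨k, l, h', h⟩, ⟨l, k, h', h.symm⟩]
  set u := f^[k] w
  have hu : u ∈ Function.periodicPts f := by
    refine ⟨l - k, by omega, ?_⟩
    rw [Function.IsPeriodicPt, Function.IsFixedPt, ← Function.iterate_add_apply,
      Nat.sub_add_cancel hkl.le, hw]
  have hpos := Function.minimalPeriod_pos_of_mem_periodicPts hu
  have hperiod : ∀ i, Function.minimalPeriod f (f^[i] u) = Function.minimalPeriod f u :=
    fun i => Function.minimalPeriod_apply_iterate hu i
  have hinj : Set.InjOn (fun i => f^[i] u) (Finset.range (Function.minimalPeriod f u)) := by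
    intro i hi j hj h
    simp only [Finset.coe_range, Set.mem_Iio] at hi hj
    exact (Function.iterate_eq_iterate_iff_of_lt_minimalPeriod hi hj).1 h
  symm
  calc _ = ∑ v ∈ (Finset.range (Function.minimalPeriod f u)).image (fun i => f^[i] u),
        (Function.minimalPeriod f v : ℝ)⁻¹ := by
        symm
        refine Finset.sum_subset ?_ ?_
        · intro v hv
          obtain ⟨i, -, rfl⟩ := Finset.mem_image.1 hv
          simp only [Finset.mem_filter, Finset.mem_univ, true_and, SimpleGraph.ConnectedComponent.eq]
          refine (reachable_iff_exists_iterate_eq f _ _).2 ⟨0, i + k, ?_⟩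
          rw [Function.iterate_add_apply]; rfl
        · intro v hv hv'
          simp only [Finset.mem_filter, Finset.mem_univ, true_and,
            SimpleGraph.ConnectedComponent.eq] at hv
          obtain ⟨i, j, hij⟩ := (reachable_iff_exists_iterate_eq f _ _).1 hv
          rw [inv_eq_zero, Nat.cast_eq_zero, Function.minimalPeriod_eq_zero_iff_notMem_periodicPts]
          intro hper
          apply hv'
          obtain ⟨p, hp, hpv⟩ := hper
          have hv1 : f^[p * (i + 1)] v = v := (hpv.mul_const (i + 1))
          have hle : i + k ≤ p * (i + 1) + k * p := by nlinarith
          have hv2 : f^[p * (i + 1) + k * p] v = v := by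
            rw [Function.iterate_add_apply, (hpv.const_mul k).eq, hv1]
          have hv3 : v = f^[p * (i + 1) + k * p - (i + k) + j] u := by
            calc v = f^[p * (i + 1) + k * p - (i + k) + k] (f^[i] v) := by
                  rw [← Function.iterate_add_apply]
                  conv_lhs => rw [← hv2]
                  congr 1
                  omega
              _ = _ := by
                  rw [hij, ← Function.iterate_add_apply, ← Function.iterate_add_apply]
                  congr 1
                  omega
          rw [Finset.mem_image]
          refine ⟨(p * (i + 1) + k * p - (i + k) + j) % Function.minimalPeriod f u,
            Finset.mem_range.2 (Nat.mod_lt _ hpos), ?_⟩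
          rw [Function.iterate_mod_minimalPeriod_eq, ← hv3]
    _ = 1 := by
        rw [Finset.sum_image hinj]
        simp only [hperiod, Finset.sum_const, Finset.card_range, nsmul_eq_mul]
        exact mul_inv_cancel₀ (by exact_mod_cast hpos.ne')

/-- The neighbour of `v` in the hypercube along direction `i`. -/
def flipAt {n : ℕ} (v : Vtx n) (i : Fin n) : Vtx n := Function.update v i (!v i)

theorem flipAt_apply {n : ℕ} (v : Vtx n) (i j : Fin n) :
    flipAt v i j = if j = i then !v j else v j := by
  by_cases h : j = i
  · subst h; simp [flipAt]
  · simp [flipAt, h]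

theorem flipAt_flipAt {n : ℕ} (v : Vtx n) (i : Fin n) : flipAt (flipAt v i) i = v := by
  funext j
  by_cases h : j = i <;> simp [flipAt_apply, h]

theorem flipAt_injective {n : ℕ} (v : Vtx n) : Function.Injective (flipAt v) := by
  intro i j h
  by_contra hij
  have := congrFun h i
  simp [flipAt_apply, hij] at this

theorem flipAt_ne {n : ℕ} (v : Vtx n) (i : Fin n) : flipAt v i ≠ v := by
  intro h
  have := congrFun h i
  simp [flipAt_apply] at this

theorem cubeGraph_adj_iff {n : ℕ} (v u : Vtx n) :
    (cubeGraph n).Adj v u ↔ ∃ i, flipAt v i = u := by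
  have hdist : hammingDist v u = 1 ↔ ∃ i, flipAt v i = u := by
    rw [hammingDist, Finset.card_eq_one]
    refine exists_congr fun i => ?_
    simp only [Finset.ext_iff, funext_iff, Finset.mem_filter, Finset.mem_univ, true_and,
      Finset.mem_singleton, flipAt_apply]
    refine forall_congr' fun j => ?_
    by_cases h : j = i
    · subst h; cases v j <;> cases u j <;> simp
    · simp [h]
  rw [cubeGraph, SimpleGraph.fromRel_adj, hammingDist_comm u v, or_self, hdist]
  exact and_iff_right_of_imp fun ⟨i, hi⟩ => hi ▸ (flipAt_ne v i).symm

/-- Choosing a neighbour of every vertex amounts to choosing a direction at every vertex. -/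
def directionEquiv (n : ℕ) : (Vtx n → Fin n) ≃ NbrChoice n :=
  Equiv.piCongrRight fun v => Equiv.ofBijective
    (fun i => ⟨flipAt v i, (cubeGraph_adj_iff v _).2 ⟨i, rfl⟩⟩)
    ⟨fun _ _ h => flipAt_injective v (Subtype.ext_iff.1 h), fun ⟨_, hu⟩ =>
      ((cubeGraph_adj_iff v _).1 hu).imp fun _ hi => Subtype.ext hi⟩

/-- The self-map of the hypercube that moves each vertex `v` in the direction `g v`. -/
def step {n : ℕ} (g : Vtx n → Fin n) (v : Vtx n) : Vtx n := flipAt v (g v)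

theorem prob_comp_equiv {Ω Ω' : Type*} [Finite Ω] [Finite Ω'] (e : Ω' ≃ Ω) (p : Ω → Prop) :
    prob p = prob fun ω => p (e ω) := by
  rw [prob, prob, Nat.card_congr e,
    Nat.card_congr (e.subtypeEquiv (p := fun ω => p (e ω)) (q := p) fun _ => Iff.rfl)]

theorem prob_componentCount (n : ℕ) (p : ℝ → Prop) :
    prob (fun ω : NbrChoice n => p (Nat.card (oneOutGraph n ω).ConnectedComponent)) =
      prob fun g : Vtx n → Fin n => p (∑ v, (Function.minimalPeriod (step g) v : ℝ)⁻¹) := by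
  rw [prob_comp_equiv (directionEquiv n)]
  congr 1
  funext g
  rw [← card_connectedComponent_eq_sum_inv_minimalPeriod]
  rfl

theorem card_filter_forall_mem_eq {V α : Type*} [Fintype V] [DecidableEq V] [Fintype α]
    [DecidableEq α] (S : Finset V) (y : V → α) :
    (Finset.univ.filter fun g : V → α => ∀ x ∈ S, g x = y x).card * Fintype.card α ^ S.card =
      Fintype.card α ^ Fintype.card V := by
  have h : (Finset.univ.filter fun g : V → α => ∀ x ∈ S, g x = y x) =
      Fintype.piFinset fun x => if x ∈ S then {y x} else Finset.univ := by
    ext g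
    simp only [Finset.mem_filter, Finset.mem_univ, true_and, Fintype.mem_piFinset]
    refine forall_congr' fun x => ?_
    by_cases hx : x ∈ S <;> simp [hx]
  rw [h, Fintype.card_piFinset, ← Finset.prod_const, ← Finset.card_univ (α := V), ← Finset.prod_const,
    ← Finset.prod_ite_mem_eq S]
  rw [← Finset.prod_mul_distrib]
  refine Finset.prod_congr rfl fun x _ => ?_
  by_cases hx : x ∈ S <;> simp [hx]

theorem card_filter_exists_flipAt_flipAt_eq_le {n : ℕ} {a v : Vtx n} (hav : a ≠ v) :
    (Finset.univ.filter fun i => ∃ j, flipAt (flipAt a i) j = v).card ≤ 2 := by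
  rcases (Finset.univ.filter fun i => ∃ j, flipAt (flipAt a i) j = v).eq_empty_or_nonempty with
    h | ⟨k, hk⟩
  · simp [h]
  · obtain ⟨l, hl⟩ := (Finset.mem_filter.1 hk).2
    refine (Finset.card_le_card (t := {k, l}) fun i hi => ?_).trans Finset.card_le_two
    obtain ⟨j, hj⟩ := (Finset.mem_filter.1 hi).2
    have hij : i ≠ j := by
      rintro rfl
      exact hav (by rw [← hj, flipAt_flipAt])
    have h := congrFun (hl.trans hj.symm) i
    simp only [flipAt_apply, hij, if_false, if_true] at h
    simp only [Finset.mem_insert, Finset.mem_singleton]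
    by_contra! hne
    simp [hne.1, hne.2] at h

theorem iterate_eq_iterate_of_eqOn {α : Type*} {f f' : α → α} {v : α} {m : ℕ}
    (h : ∀ k < m, f' (f^[k] v) = f (f^[k] v)) : f'^[m] v = f^[m] v := by
  induction m with
  | zero => rfl
  | succ m ih =>
    rw [Function.iterate_succ_apply', ih fun k hk => h k (by omega), h m (by omega),
      Function.iterate_succ_apply']

theorem card_filter_minimalPeriod_eq_mul_sq_le {n : ℕ} (v : Vtx n) {t : ℕ} (ht : 3 ≤ t) :
    (Finset.univ.filter fun g => Function.minimalPeriod (step g) v = t).card * n ^ 2 ≤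
      2 * Fintype.card (Vtx n → Fin n) := by
  obtain ⟨m, rfl⟩ : ∃ m, t = m + 2 := ⟨t - 2, by omega⟩
  set A := Finset.univ.filter fun g => Function.minimalPeriod (step g) v = m + 2
  let pre (g : Vtx n → Fin n) : Vtx n := (step g)^[m] v
  let redirect (x : (Vtx n → Fin n) × Fin n × Fin n) : Vtx n → Fin n :=
    Function.update (Function.update x.1 (pre x.1) x.2.1) (step x.1 (pre x.1)) x.2.2
  let B : Finset ((_ : Vtx n → Fin n) × Fin n) := Finset.univ.sigma fun g =>
    if pre g = v then ∅ else Finset.univ.filter fun i => ∃ j, flipAt (flipAt (pre g) i) j = v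
  have hdistinct : ∀ g ∈ A, ∀ i < m + 2, ∀ j < m + 2, (step g)^[i] v = (step g)^[j] v → i = j := by
    intro g hg i hi j hj h
    have hg' := (Finset.mem_filter.1 hg).2
    exact (Function.iterate_eq_iterate_iff_of_lt_minimalPeriod (by omega) (by omega)).1 h
  have hclose : ∀ g ∈ A, step g (step g (pre g)) = v := by
    intro g hg
    have h := Function.iterate_minimalPeriod (f := step g) (x := v)
    rwa [(Finset.mem_filter.1 hg).2, Function.iterate_succ_apply',
      Function.iterate_succ_apply'] at h
  have hsucc : ∀ g, step g (pre g) = (step g)^[m + 1] v := fun g =>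
    (Function.iterate_succ_apply' _ _ _).symm
  have hpre : ∀ x, x.1 ∈ A → pre (redirect x) = pre x.1 := by
    intro x hx
    refine iterate_eq_iterate_of_eqOn fun k hk => ?_
    have h₁ : (step x.1)^[k] v ≠ pre x.1 := fun h => by
      have := hdistinct _ hx k (by omega) m (by omega) h
      omega
    have h₂ : (step x.1)^[k] v ≠ step x.1 (pre x.1) := fun h => by
      have := hdistinct _ hx k (by omega) (m + 1) (by omega) (h.trans (hsucc _))
      omega
    simp only [step] at h₁ h₂ ⊢
    simp only [redirect, step, Function.update_of_ne h₂, Function.update_of_ne h₁]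
  have hcard : (A ×ˢ (Finset.univ : Finset (Fin n × Fin n))).card ≤ B.card := by
    refine Finset.card_le_card_of_injOn (fun x => ⟨redirect x, x.1 (pre x.1)⟩) ?_ ?_
    · intro x hx
      have hxA : x.1 ∈ A := (Finset.mem_product.1 hx).1
      have hne : pre x.1 ≠ v := fun h => by
        have := hdistinct _ hxA m (by omega) 0 (by omega) h
        omega
      simp only [B, Finset.coe_sigma, Set.mem_sigma_iff, Finset.coe_univ, Set.mem_univ, true_and,
        hpre x hxA, if_neg hne, Finset.mem_coe, Finset.mem_filter, Finset.mem_univ]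
      exact ⟨_, hclose _ hxA⟩
    · rintro x hx y hy hxy
      have hxA : x.1 ∈ A := (Finset.mem_product.1 hx).1
      have hyA : y.1 ∈ A := (Finset.mem_product.1 hy).1
      obtain ⟨hr, hi⟩ : redirect x = redirect y ∧ x.1 (pre x.1) = y.1 (pre y.1) := by
        simpa using hxy
      have ha : pre x.1 = pre y.1 := by rw [← hpre x hxA, ← hpre y hyA, hr]
      have hb : step x.1 (pre x.1) = step y.1 (pre y.1) := by rw [step, step, hi, ha]
      have hj : x.1 (step x.1 (pre x.1)) = y.1 (step y.1 (pre y.1)) := by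
        refine flipAt_injective (step x.1 (pre x.1)) ?_
        have h := (hclose _ hxA).trans (hclose _ hyA).symm
        rw [step, step.eq_def y.1] at h
        rw [h, hb]
      have hab : pre y.1 ≠ step y.1 (pre y.1) := (flipAt_ne _ _).symm
      have hval : ∀ w, redirect x w = redirect y w := congrFun hr
      simp only [redirect, ha, show step x.1 (pre y.1) = step y.1 (pre y.1) from ha ▸ hb] at hval
      have h₁ : x.2.2 = y.2.2 := by simpa using hval (step y.1 (pre y.1))
      have h₂ : x.2.1 = y.2.1 := by simpa [Function.update_of_ne hab] using hval (pre y.1)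
      refine Prod.ext (funext fun w => ?_) (Prod.ext h₂ h₁)
      by_cases hwb : w = step y.1 (pre y.1)
      · rw [hwb, ← hj, hb]
      by_cases hwa : w = pre y.1
      · rw [hwa, ← hi, ha]
      simpa [Function.update_of_ne hwb, Function.update_of_ne hwa] using hval w
  have hB : B.card ≤ 2 * Fintype.card (Vtx n → Fin n) := by
    rw [Finset.card_sigma, mul_comm, ← Finset.card_univ]
    refine Finset.sum_le_card_nsmul _ _ _ fun g _ => ?_
    split_ifs with h
    · simp
    · exact card_filter_exists_flipAt_flipAt_eq_le h
  rw [Finset.card_product, Finset.card_univ, Fintype.card_prod, Fintype.card_fin, ← sq] at hcard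
  exact hcard.trans hB

theorem sum_indicator_forall_mem_eq {V α : Type*} [Fintype V] [DecidableEq V] [Fintype α] [DecidableEq α]
    [Nonempty α] (S : Finset V) (y : V → α) :
    (∑ g : V → α, if ∀ x ∈ S, g x = y x then (1 : ℝ) else 0) =
      Fintype.card (V → α) / (Fintype.card α : ℝ) ^ S.card := by
  have hα : (Fintype.card α : ℝ) ≠ 0 := by exact_mod_cast Fintype.card_ne_zero
  rw [Finset.sum_boole, eq_div_iff (pow_ne_zero _ hα), Fintype.card_fun]
  exact_mod_cast card_filter_forall_mem_eq S y

/-- The indicator that the edge from `p.1` in direction `p.2` is chosen by both its endpoints. -/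
def mutualEdge {n : ℕ} (p : Vtx n × Fin n) (g : Vtx n → Fin n) : ℝ :=
  if ∀ x ∈ ({p.1, flipAt p.1 p.2} : Finset (Vtx n)), g x = p.2 then 1 else 0

theorem sum_mutualEdge {n : ℕ} (p : Vtx n × Fin n) :
    ∑ g, mutualEdge p g = Fintype.card (Vtx n → Fin n) / (n : ℝ) ^ 2 := by
  have : Nonempty (Fin n) := ⟨p.2⟩
  simp only [mutualEdge]
  rw [sum_indicator_forall_mem_eq _ fun _ => p.2, Finset.card_pair (flipAt_ne _ _).symm,
    Fintype.card_fin]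

theorem sum_mutualEdge_mul_mutualEdge_le {n : ℕ} (p q : Vtx n × Fin n) :
    ∑ g, mutualEdge p g * mutualEdge q g ≤
      Fintype.card (Vtx n → Fin n) / (n : ℝ) ^ 4 +
        if q ∈ ({p, (flipAt p.1 p.2, p.2)} : Finset (Vtx n × Fin n)) then
          Fintype.card (Vtx n → Fin n) / (n : ℝ) ^ 2 else 0 := by
  have : Nonempty (Fin n) := ⟨p.2⟩
  have hnonneg : (0 : ℝ) ≤ Fintype.card (Vtx n → Fin n) / (n : ℝ) ^ 4 := by positivity
  split_ifs with hq
  · refine le_add_of_nonneg_of_le hnonneg ?_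
    rw [← sum_mutualEdge p]
    refine Finset.sum_le_sum fun g _ => ?_
    simp only [mutualEdge]
    split_ifs <;> norm_num
  · rw [add_zero]
    by_cases hd : Disjoint ({p.1, flipAt p.1 p.2} : Finset (Vtx n)) {q.1, flipAt q.1 q.2}
    · have hcard : (({p.1, flipAt p.1 p.2} : Finset (Vtx n)) ∪ {q.1, flipAt q.1 q.2}).card = 4 := by
        rw [Finset.card_union_of_disjoint hd, Finset.card_pair (flipAt_ne _ _).symm,
          Finset.card_pair (flipAt_ne _ _).symm]
      refine le_of_eq ?_
      rw [← hcard]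
      have h := sum_indicator_forall_mem_eq
        (({p.1, flipAt p.1 p.2} : Finset (Vtx n)) ∪ {q.1, flipAt q.1 q.2})
        fun x => if x ∈ ({p.1, flipAt p.1 p.2} : Finset (Vtx n)) then p.2 else q.2
      rw [Fintype.card_fin] at h
      rw [← h]
      refine Finset.sum_congr rfl fun g _ => ?_
      have hiff : (∀ x ∈ ({p.1, flipAt p.1 p.2} : Finset (Vtx n)) ∪ {q.1, flipAt q.1 q.2},
          g x = if x ∈ ({p.1, flipAt p.1 p.2} : Finset (Vtx n)) then p.2 else q.2) ↔
          (∀ x ∈ ({p.1, flipAt p.1 p.2} : Finset (Vtx n)), g x = p.2) ∧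
          ∀ x ∈ ({q.1, flipAt q.1 q.2} : Finset (Vtx n)), g x = q.2 := by
        simp only [Finset.mem_union, or_imp, forall_and]
        refine and_congr (forall₂_congr fun x hx => by rw [if_pos hx])
          (forall₂_congr fun x hx => by rw [if_neg (Finset.disjoint_right.1 hd hx)])
      simp only [mutualEdge, hiff, ite_and, mul_ite, mul_one, mul_zero]
      split_ifs <;> rfl
    · obtain ⟨x, hx, hx'⟩ := Finset.not_disjoint_iff.1 hd
      refine le_of_eq_of_le (Finset.sum_eq_zero fun g _ => ?_) hnonneg
      simp only [mutualEdge]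
      split_ifs with h₁ h₂ <;> try simp only [mul_zero, zero_mul]
      exfalso
      apply hq
      have hpq : p.2 = q.2 := (h₁ x hx).symm.trans (h₂ x hx')
      obtain ⟨v, i⟩ := p
      obtain ⟨w, j⟩ := q
      obtain rfl : i = j := hpq
      simp only [Finset.mem_insert, Finset.mem_singleton, Prod.mk.injEq, and_true] at hx hx' ⊢
      rcases hx with rfl | rfl <;> rcases hx' with h | h
      · exact Or.inl h.symm
      · exact Or.inr (by rw [h, flipAt_flipAt])
      · exact Or.inr h.symm
      · exact Or.inl (by rw [← flipAt_flipAt w i, ← h, flipAt_flipAt])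

theorem minimalPeriod_step_ne_one {n : ℕ} (g : Vtx n → Fin n) (v : Vtx n) :
    Function.minimalPeriod (step g) v ≠ 1 := by
  rw [Ne, Function.minimalPeriod_eq_one_iff_isFixedPt]
  exact flipAt_ne _ _

theorem minimalPeriod_step_eq_two_iff {n : ℕ} (g : Vtx n → Fin n) (v : Vtx n) :
    Function.minimalPeriod (step g) v = 2 ↔ g (flipAt v (g v)) = g v := by
  have hstep : Function.IsPeriodicPt (step g) 2 v ↔ g (flipAt v (g v)) = g v := by
    change flipAt (flipAt v (g v)) (g (flipAt v (g v))) = v ↔ _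
    conv_lhs => rhs; rw [← flipAt_flipAt v (g v)]
    exact (flipAt_injective _).eq_iff
  rw [← hstep]
  refine ⟨fun h => h ▸ Function.isPeriodicPt_minimalPeriod _ _, fun h => ?_⟩
  exact ((Nat.dvd_prime Nat.prime_two).1 h.minimalPeriod_dvd).resolve_left
    (minimalPeriod_step_ne_one g v)

/-- The number of vertices lying on cycles of length two. -/
def twoCyclic {n : ℕ} (g : Vtx n → Fin n) : ℝ := ∑ p, mutualEdge p g

/-- The number of components of the functional graph whose cycle has length at least three. -/
def longCyclic {n : ℕ} (g : Vtx n → Fin n) : ℝ :=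
  ∑ v, if 3 ≤ Function.minimalPeriod (step g) v then
    (Function.minimalPeriod (step g) v : ℝ)⁻¹ else 0

theorem sum_inv_minimalPeriod_step {n : ℕ} (g : Vtx n → Fin n) :
    ∑ v, (Function.minimalPeriod (step g) v : ℝ)⁻¹ = twoCyclic g / 2 + longCyclic g := by
  rw [twoCyclic, longCyclic, Fintype.sum_prod_type, Finset.sum_div, ← Finset.sum_add_distrib]
  refine Finset.sum_congr rfl fun v _ => ?_
  have htwo : ∑ i, mutualEdge (v, i) g =
      if Function.minimalPeriod (step g) v = 2 then 1 else 0 := by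
    rw [Finset.sum_eq_single (g v)]
    · simp [mutualEdge, minimalPeriod_step_eq_two_iff]
    · intro i _ hi
      simp [mutualEdge, hi.symm]
    · simp
  rw [htwo]
  have hne := minimalPeriod_step_ne_one g v
  generalize Function.minimalPeriod (step g) v = t at *
  rcases Nat.lt_or_ge t 3 with ht | ht
  · interval_cases t <;> norm_num at *
  · simp [ht, show t ≠ 2 by omega]

theorem longCyclic_nonneg {n : ℕ} (g : Vtx n → Fin n) : 0 ≤ longCyclic g :=
  Finset.sum_nonneg fun _ _ => by split_ifs <;> positivity

theorem sum_twoCyclic (n : ℕ) (hn : n ≠ 0) :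
    ∑ g : Vtx n → Fin n, twoCyclic g = Fintype.card (Vtx n → Fin n) * (2 ^ n / n : ℝ) := by
  simp only [twoCyclic]
  rw [Finset.sum_comm]
  simp only [sum_mutualEdge, Finset.sum_const, Finset.card_univ, Fintype.card_prod,
    Fintype.card_fin, Fintype.card_pi_const, Fintype.card_bool, nsmul_eq_mul]
  push_cast
  field_simp

theorem sum_twoCyclic_sq_le (n : ℕ) (hn : n ≠ 0) :
    ∑ g : Vtx n → Fin n, twoCyclic g ^ 2 ≤
      Fintype.card (Vtx n → Fin n) * ((2 ^ n / n : ℝ) ^ 2 + 2 * (2 ^ n / n)) := by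
  set W : ℝ := ((Fintype.card (Vtx n → Fin n) : ℕ) : ℝ) with hW
  calc ∑ g : Vtx n → Fin n, twoCyclic g ^ 2
      = ∑ p : Vtx n × Fin n, ∑ q : Vtx n × Fin n, ∑ g, mutualEdge p g * mutualEdge q g := by
        simp only [twoCyclic, sq, Finset.sum_mul_sum]
        rw [Finset.sum_comm]
        exact Finset.sum_congr rfl fun p _ => Finset.sum_comm
    _ ≤ ∑ p : Vtx n × Fin n, ∑ q : Vtx n × Fin n, (W / (n : ℝ) ^ 4 +
          if q ∈ ({p, (flipAt p.1 p.2, p.2)} : Finset (Vtx n × Fin n)) then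
            W / (n : ℝ) ^ 2 else 0) :=
        Finset.sum_le_sum fun p _ => Finset.sum_le_sum fun q _ =>
          sum_mutualEdge_mul_mutualEdge_le p q
    _ = ∑ p : Vtx n × Fin n, (2 ^ n * n * (W / (n : ℝ) ^ 4) + 2 * (W / (n : ℝ) ^ 2)) := by
        refine Finset.sum_congr rfl fun p _ => ?_
        have hne : p ≠ (flipAt p.1 p.2, p.2) := fun h =>
          flipAt_ne p.1 p.2 (congrArg Prod.fst h).symm
        rw [Finset.sum_add_distrib, Finset.sum_ite_mem, Finset.univ_inter, Finset.sum_const,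
          Finset.sum_const, Finset.card_pair hne]
        simp
    _ = W * ((2 ^ n / n : ℝ) ^ 2 + 2 * (2 ^ n / n)) := by
        rw [Finset.sum_const]
        simp only [Finset.card_univ, Fintype.card_prod, Fintype.card_fin, Fintype.card_pi_const,
          Fintype.card_bool, nsmul_eq_mul]
        push_cast
        field_simp

theorem sum_twoCyclic_sub_sq_le (n : ℕ) (hn : n ≠ 0) :
    ∑ g : Vtx n → Fin n, (twoCyclic g - 2 ^ n / n) ^ 2 ≤
      Fintype.card (Vtx n → Fin n) * (2 * (2 ^ n / n : ℝ)) := by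
  have hexpand : ∑ g : Vtx n → Fin n, (twoCyclic g - 2 ^ n / n) ^ 2 =
      ∑ g : Vtx n → Fin n, twoCyclic g ^ 2 - 2 * (2 ^ n / n) * ∑ g : Vtx n → Fin n, twoCyclic g +
        Fintype.card (Vtx n → Fin n) * (2 ^ n / n : ℝ) ^ 2 := by
    rw [Finset.mul_sum, ← Finset.sum_sub_distrib, ← Finset.card_univ, ← nsmul_eq_mul,
      ← Finset.sum_const, ← Finset.sum_add_distrib]
    exact Finset.sum_congr rfl fun _ _ => by ring
  rw [hexpand, sum_twoCyclic n hn]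
  linarith [sum_twoCyclic_sq_le n hn]

theorem sum_longCyclic_le (n : ℕ) (hn : n ≠ 0) :
    ∑ g : Vtx n → Fin n, longCyclic g ≤
      Fintype.card (Vtx n → Fin n) * (2 ^ n * (3 + 4 * Real.log n) / (n : ℝ) ^ 2) := by
  set W : ℝ := ((Fintype.card (Vtx n → Fin n) : ℕ) : ℝ) with hW
  have hn' : (0 : ℝ) < n := by exact_mod_cast Nat.pos_of_ne_zero hn
  have hpoint : ∀ t : ℕ, (if 3 ≤ t then (t : ℝ)⁻¹ else 0) ≤
      ∑ s ∈ Finset.Icc 3 (n ^ 2), (s : ℝ)⁻¹ * (if t = s then 1 else 0) + ((n : ℝ) ^ 2)⁻¹ := by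
    intro t
    simp only [mul_ite, mul_one, mul_zero, Finset.sum_ite_eq, Finset.mem_Icc]
    by_cases h₁ : 3 ≤ t
    · by_cases h₂ : t ≤ n ^ 2
      · simp only [h₁, h₂, and_self, if_true]
        linarith [show (0 : ℝ) ≤ ((n : ℝ) ^ 2)⁻¹ by positivity]
      · simp only [h₁, h₂, and_false, if_true, if_false, zero_add]
        have : (n : ℝ) ^ 2 ≤ t := by exact_mod_cast (not_le.1 h₂).le
        gcongr
    · simp only [h₁, false_and, if_false, zero_add]
      positivity
  have hcount : ∀ (v : Vtx n), ∀ s ∈ Finset.Icc 3 (n ^ 2),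
      ∑ g : Vtx n → Fin n, (if Function.minimalPeriod (step g) v = s then (1 : ℝ) else 0) ≤
        2 * W / (n : ℝ) ^ 2 := by
    intro v s hs
    rw [Finset.sum_boole, le_div_iff₀ (by positivity), hW]
    exact_mod_cast card_filter_minimalPeriod_eq_mul_sq_le v (Finset.mem_Icc.1 hs).1
  have hharmonic : ∑ s ∈ Finset.Icc 3 (n ^ 2), (s : ℝ)⁻¹ ≤ 1 + 2 * Real.log n := by
    have h := harmonic_le_one_add_log (n ^ 2)
    rw [harmonic_eq_sum_Icc] at h
    push_cast at h
    rw [Real.log_pow] at h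
    push_cast at h
    refine le_trans (Finset.sum_le_sum_of_subset_of_nonneg
      (Finset.Icc_subset_Icc_left (by norm_num)) fun _ _ _ => by positivity) h
  calc ∑ g : Vtx n → Fin n, longCyclic g
      ≤ ∑ g : Vtx n → Fin n, ∑ v, (∑ s ∈ Finset.Icc 3 (n ^ 2), (s : ℝ)⁻¹ *
          (if Function.minimalPeriod (step g) v = s then 1 else 0) + ((n : ℝ) ^ 2)⁻¹) :=
        Finset.sum_le_sum fun g _ => Finset.sum_le_sum fun v _ => hpoint _
    _ = ∑ v : Vtx n, (∑ s ∈ Finset.Icc 3 (n ^ 2), (s : ℝ)⁻¹ * ∑ g : Vtx n → Fin n,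
          (if Function.minimalPeriod (step g) v = s then 1 else 0) + W * ((n : ℝ) ^ 2)⁻¹) := by
        rw [Finset.sum_comm]
        refine Finset.sum_congr rfl fun v _ => ?_
        rw [Finset.sum_add_distrib, Finset.sum_comm, Finset.sum_const, Finset.card_univ,
          nsmul_eq_mul]
        simp only [Finset.mul_sum]
        rfl
    _ ≤ ∑ v : Vtx n, ((1 + 2 * Real.log n) * (2 * W / (n : ℝ) ^ 2) + W * ((n : ℝ) ^ 2)⁻¹) := by
        refine Finset.sum_le_sum fun v _ => ?_
        gcongr
        refine le_trans (Finset.sum_le_sum fun s hs =>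
          mul_le_mul_of_nonneg_left (hcount v s hs) (by positivity)) ?_
        rw [← Finset.sum_mul]
        gcongr
    _ = W * (2 ^ n * (3 + 4 * Real.log n) / (n : ℝ) ^ 2) := by
        rw [Finset.sum_const]
        simp only [Finset.card_univ, Fintype.card_pi_const, Fintype.card_bool, nsmul_eq_mul]
        push_cast
        field_simp
        ring

theorem prob_le_of_sum_le {Ω : Type*} [Fintype Ω] [Nonempty Ω] {p : Ω → Prop} {X : Ω → ℝ}
    {a b : ℝ} (ha : 0 < a) (hX : ∀ ω, 0 ≤ X ω) (hp : ∀ ω, p ω → a ≤ X ω)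
    (hsum : ∑ ω, X ω ≤ Fintype.card Ω * b) : prob p ≤ b / a := by
  have hΩ : (0 : ℝ) < Fintype.card Ω := by exact_mod_cast Fintype.card_pos
  rw [prob, Nat.card_eq_fintype_card, Nat.card_eq_fintype_card, Fintype.card_subtype,
    div_le_div_iff₀ hΩ ha]
  calc ((Finset.univ.filter p).card : ℝ) * a = ∑ ω ∈ Finset.univ.filter p, a := by
        rw [Finset.sum_const, nsmul_eq_mul]
    _ ≤ ∑ ω ∈ Finset.univ.filter p, X ω :=
        Finset.sum_le_sum fun ω hω => hp ω (Finset.mem_filter.1 hω).2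
    _ ≤ ∑ ω, X ω := Finset.sum_le_sum_of_subset_of_nonneg (Finset.filter_subset _ _)
        fun ω _ _ => hX ω
    _ ≤ b * Fintype.card Ω := by rwa [mul_comm]

theorem prob_le_one {Ω : Type*} [Finite Ω] (p : Ω → Prop) : prob p ≤ 1 :=
  div_le_one_of_le₀ (by exact_mod_cast Finite.card_subtype_le p) (by positivity)

theorem one_le_prob_add_prob_add_prob {Ω : Type*} [Finite Ω] [Nonempty Ω] {p q r : Ω → Prop}
    (h : ∀ ω, p ω ∨ q ω ∨ r ω) : 1 ≤ prob p + prob q + prob r := by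
  have := Fintype.ofFinite Ω
  have hΩ : (0 : ℝ) < Fintype.card Ω := by exact_mod_cast Fintype.card_pos
  simp only [prob, Nat.card_eq_fintype_card, Fintype.card_subtype]
  rw [← add_div, ← add_div, one_le_div hΩ, ← Finset.card_univ]
  have hcover : (Finset.univ : Finset Ω) ⊆
      (Finset.univ.filter p ∪ Finset.univ.filter q) ∪ Finset.univ.filter r := by
    intro ω _
    simpa [or_assoc] using h ω
  have h₁ := Finset.card_le_card hcover
  have h₂ := Finset.card_union_le (Finset.univ.filter p ∪ Finset.univ.filter q)
    (Finset.univ.filter r)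
  have h₃ := Finset.card_union_le (Finset.univ.filter p) (Finset.univ.filter q)
  exact_mod_cast h₁.trans (h₂.trans (Nat.add_le_add_right h₃ _))

theorem one_sub_le_prob_componentCount {ε : ℝ} (hε : 0 < ε) {n : ℕ} (hn : n ≠ 0) :
    1 - 8 / ε ^ 2 * (n / 2 ^ n) - 4 / ε * ((3 + 4 * Real.log n) / n) ≤
      prob fun ω : NbrChoice n =>
        (1 - ε) * 2 ^ (n - 1) / n ≤ (Nat.card (oneOutGraph n ω).ConnectedComponent : ℝ) ∧
        (Nat.card (oneOutGraph n ω).ConnectedComponent : ℝ) ≤ (1 + ε) * 2 ^ (n - 1) / n := by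
  have hn' : (0 : ℝ) < n := by exact_mod_cast Nat.pos_of_ne_zero hn
  have : Nonempty (Fin n) := ⟨⟨0, Nat.pos_of_ne_zero hn⟩⟩
  rw [prob_componentCount n fun x => (1 - ε) * 2 ^ (n - 1) / n ≤ x ∧ x ≤ (1 + ε) * 2 ^ (n - 1) / n]
  set μ : ℝ := 2 ^ n / n with hμ
  have hμ_pos : 0 < μ := by positivity
  have hhalf : (2 : ℝ) ^ (n - 1) / n = μ / 2 := by
    obtain ⟨m, rfl⟩ := Nat.exists_eq_succ_of_ne_zero hn
    rw [hμ, Nat.succ_eq_add_one, Nat.add_sub_cancel, pow_succ]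
    ring
  have htwo : prob (fun g : Vtx n → Fin n => ε * μ / 2 < |twoCyclic g - μ|) ≤
      2 * μ / (ε * μ / 2) ^ 2 := by
    refine prob_le_of_sum_le (X := fun g => (twoCyclic g - μ) ^ 2) (by positivity)
      (fun _ => sq_nonneg _) (fun g hg => ?_) (sum_twoCyclic_sub_sq_le n hn)
    rw [← sq_abs (twoCyclic g - μ)]
    gcongr
  have hlong : prob (fun g : Vtx n → Fin n => ε * μ / 4 < longCyclic g) ≤
      2 ^ n * (3 + 4 * Real.log n) / (n : ℝ) ^ 2 / (ε * μ / 4) :=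
    prob_le_of_sum_le (by positivity) longCyclic_nonneg (fun _ => le_of_lt)
      (sum_longCyclic_le n hn)
  have hcover := one_le_prob_add_prob_add_prob (Ω := Vtx n → Fin n)
    (p := fun g => (1 - ε) * 2 ^ (n - 1) / n ≤ ∑ v, (Function.minimalPeriod (step g) v : ℝ)⁻¹ ∧
      ∑ v, (Function.minimalPeriod (step g) v : ℝ)⁻¹ ≤ (1 + ε) * 2 ^ (n - 1) / n)
    (q := fun g => ε * μ / 2 < |twoCyclic g - μ|) (r := fun g => ε * μ / 4 < longCyclic g) (by
      intro g
      by_contra! h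
      obtain ⟨h₁, h₂, h₃⟩ := h
      rw [abs_le] at h₂
      have h₄ := longCyclic_nonneg g
      have hεμ : 0 < ε * μ := by positivity
      rw [sum_inv_minimalPeriod_step, mul_div_assoc, mul_div_assoc, hhalf] at h₁
      linarith [h₁ (by linarith)])
  have e₁ : 2 * μ / (ε * μ / 2) ^ 2 = 8 / ε ^ 2 * (n / 2 ^ n) := by
    rw [hμ]; field_simp; ring
  have e₂ : 2 ^ n * (3 + 4 * Real.log n) / (n : ℝ) ^ 2 / (ε * μ / 4) =
      4 / ε * ((3 + 4 * Real.log n) / n) := by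
    rw [hμ]; field_simp
  rw [e₁] at htwo
  rw [e₂] at hlong
  linarith

theorem tendsto_prob_lower_bound (a b : ℝ) :
    Tendsto (fun n : ℕ => 1 - a * (n / 2 ^ n) - b * ((3 + 4 * Real.log n) / n))
      atTop (nhds 1) := by
  have h₁ : Tendsto (fun n : ℕ => (n : ℝ) / 2 ^ n) atTop (nhds 0) := by
    simpa using tendsto_pow_const_div_const_pow_of_one_lt 1 (one_lt_two : (1 : ℝ) < 2)
  have h₂ : Tendsto (fun n : ℕ => Real.log n / n) atTop (nhds 0) :=
    (Real.isLittleO_log_id_atTop.tendsto_div_nhds_zero).comp tendsto_natCast_atTop_atTop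
  have h₃ : Tendsto (fun n : ℕ => (3 + 4 * Real.log n) / n) atTop (nhds 0) := by
    have h := (tendsto_const_div_atTop_nhds_zero_nat (3 : ℝ)).add (h₂.const_mul 4)
    simp only [mul_zero, add_zero] at h
    refine h.congr fun n => by ring
  simpa using (tendsto_const_nhds.sub (h₁.const_mul a)).sub (h₃.const_mul b)

/-- For every `ε > 0`, w.h.p. the number of connected components of `Q^n(1)` lies
between `(1−ε)·2^{n−1}/n` and `(1+ε)·2^{n−1}/n`. -/
theorem stmt_12 (ε : ℝ) (hε : 0 < ε) :
    Tendsto (fun n : ℕ =>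
        prob (fun ω : NbrChoice n =>
          (1 - ε) * 2 ^ (n - 1) / n ≤ (Nat.card (oneOutGraph n ω).ConnectedComponent : ℝ) ∧
          (Nat.card (oneOutGraph n ω).ConnectedComponent : ℝ) ≤ (1 + ε) * 2 ^ (n - 1) / n))
      atTop (nhds 1) := by
  refine tendsto_of_tendsto_of_tendsto_of_le_of_le'
    (tendsto_prob_lower_bound (8 / ε ^ 2) (4 / ε)) tendsto_const_nhds ?_
    (Eventually.of_forall fun n => prob_le_one _)
  filter_upwards [eventually_ne_atTop 0] with n hn
  exact one_sub_le_prob_componentCount hε hn
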